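/- Let H be a symmetric positive semidefinite matrix on ℝ^{n+m}, θ : ℝⁿ → ℝ, F(x, λ) := (−Aᵀλ, Ax − b) for A ∈ ℝ^{m×n} and b ∈ ℝᵐ, and Ω ⊆ ℝⁿ × ℝᵐ. Suppose w̃ᵏ = (x̃ᵏ, λ̃ᵏ) ∈ Ω and wᵏ ∈ ℝⁿ × ℝᵐ satisfy θ(x) − θ(x̃ᵏ) + ⟨w − w̃ᵏ, F(w̃ᵏ)⟩ ≥ ⟨w − w̃ᵏ, H(wᵏ − w̃ᵏ)⟩ for all w = (x, λ) ∈ Ω, and let w^{k+1} := wᵏ − α(wᵏ − w̃ᵏ) for some α ∈ (0, 2). Then for all w = (x, λ) ∈ Ω: α(θ(x) − θ(x̃ᵏ) + ⟨w − w̃ᵏ, F(w)⟩) ≥ (1/2)(‖w − w^{k+1}‖²_H − ‖w − wᵏ‖²_H) + (α(2 − α)/2) ‖wᵏ − w̃ᵏ‖²_H. -/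

import Mathlib

open Matrix

/-- The quadratic form `‖v‖²_H = vᵀ H v` associated with a matrix `H`. -/
def quadH {α : Type*} [Fintype α] (H : Matrix α α ℝ) (v : α → ℝ) : ℝ :=
  v ⬝ᵥ (H *ᵥ v)

/-- Expansion of the quadratic form of a symmetric matrix along a line. -/
theorem quadH_sub_smul {ι : Type*} [Fintype ι] {H : Matrix ι ι ℝ} (hH : H.IsSymm)
    (u d : ι → ℝ) (c : ℝ) :
    quadH H (u - c • d) = quadH H u - 2 * c * (u ⬝ᵥ (H *ᵥ d)) + c ^ 2 * quadH H d := by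
  have h : d ⬝ᵥ (H *ᵥ u) = u ⬝ᵥ (H *ᵥ d) := by
    rw [dotProduct_mulVec, ← mulVec_transpose, hH.eq, dotProduct_comm]
  simp only [quadH, mulVec_sub, mulVec_smul, dotProduct_sub, sub_dotProduct, smul_dotProduct,
    dotProduct_smul, smul_eq_mul, h]
  ring

/-- For the affine map `F (x, l) = (-Aᵀ l, A x - b)`, whose linear part is skew-symmetric,
`⟨w - w', F w⟩ = ⟨w - w', F w'⟩`. -/
theorem skew_affine_dotProduct_eq {ι κ : Type*} [Fintype ι] [Fintype κ] (A : Matrix κ ι ℝ)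
    (b : κ → ℝ) (x x' : ι → ℝ) (l l' : κ → ℝ) :
    (x - x') ⬝ᵥ (-(Aᵀ *ᵥ l)) + (l - l') ⬝ᵥ (A *ᵥ x - b) =
      (x - x') ⬝ᵥ (-(Aᵀ *ᵥ l')) + (l - l') ⬝ᵥ (A *ᵥ x' - b) := by
  have h (y : ι → ℝ) (p : κ → ℝ) : y ⬝ᵥ (Aᵀ *ᵥ p) = p ⬝ᵥ (A *ᵥ y) := by
    rw [dotProduct_mulVec, vecMul_transpose, dotProduct_comm]
  simp only [dotProduct_neg, h, mulVec_sub, dotProduct_sub, sub_dotProduct]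
  ring

/-- the key inequality for the generalized (relaxed) version of the
balanced ALM with relaxation factor `α ∈ (0, 2)` and
`w^{k+1} = wᵏ − α(wᵏ − w̃ᵏ)`. -/
theorem stmt_14 {m n : ℕ} (A : Matrix (Fin m) (Fin n) ℝ) (b : Fin m → ℝ)
    (θ : (Fin n → ℝ) → ℝ)
    (H : Matrix (Fin n ⊕ Fin m) (Fin n ⊕ Fin m) ℝ) (hH : H.PosSemidef)
    (Ω : Set ((Fin n → ℝ) × (Fin m → ℝ)))
    (xt : Fin n → ℝ) (lt : Fin m → ℝ) (hmem : (xt, lt) ∈ Ω)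
    (xk : Fin n → ℝ) (lk : Fin m → ℝ)
    (hvi : ∀ w ∈ Ω,
      θ w.1 - θ xt + ((w.1 - xt) ⬝ᵥ (-(Aᵀ *ᵥ lt)) + (w.2 - lt) ⬝ᵥ (A *ᵥ xt - b)) ≥
        Sum.elim (w.1 - xt) (w.2 - lt) ⬝ᵥ (H *ᵥ Sum.elim (xk - xt) (lk - lt)))
    (α : ℝ) (hα : α ∈ Set.Ioo (0 : ℝ) 2)
    (xn : Fin n → ℝ) (ln : Fin m → ℝ)
    (hxn : xn = xk - α • (xk - xt)) (hln : ln = lk - α • (lk - lt)) :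
    ∀ w ∈ Ω,
      α * (θ w.1 - θ xt +
          ((w.1 - xt) ⬝ᵥ (-(Aᵀ *ᵥ w.2)) + (w.2 - lt) ⬝ᵥ (A *ᵥ w.1 - b))) ≥
        1 / 2 * (quadH H (Sum.elim (w.1 - xn) (w.2 - ln)) -
            quadH H (Sum.elim (w.1 - xk) (w.2 - lk))) +
          α * (2 - α) / 2 * quadH H (Sum.elim (xk - xt) (lk - lt)) := by
  intro w hw
  have hαd := mul_le_mul_of_nonneg_left (hvi w hw) hα.1.le
  rw [← skew_affine_dotProduct_eq A b w.1 xt w.2 lt] at hαd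
  have hn : Sum.elim (w.1 - xn) (w.2 - ln) =
      Sum.elim (w.1 - xt) (w.2 - lt) - (1 - α) • Sum.elim (xk - xt) (lk - lt) := by
    subst hxn hln
    ext (i | i) <;> simp <;> ring
  have hk : Sum.elim (w.1 - xk) (w.2 - lk) =
      Sum.elim (w.1 - xt) (w.2 - lt) - (1 : ℝ) • Sum.elim (xk - xt) (lk - lt) := by
    ext (i | i) <;> simp
  have hsymm : H.IsSymm := by simpa using hH.isHermitian
  rw [hn, hk, quadH_sub_smul hsymm, quadH_sub_smul hsymm]
  linarith
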